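/- Let F be a probability distribution supported on (0,∞) with finite mean. Then for every u ∈ (0,1): (i) F_u(dx) = u^{−1} e^{−xφ^{−1}(u)} F(dx) is a probability measure on (0,∞) with mean μ_u := ∫ x F_u(dx) = −φ'(φ^{−1}(u))/u; (ii) G_u(dx) = x F_u(dx)/μ_u; and (iii) for every x > 0 the function s ↦ x e^{−xφ^{−1}(s)}/(−φ'(φ^{−1}(s))) satisfies ∫_0^u x e^{−xφ^{−1}(s)}/(−φ'(φ^{−1}(s))) ds = e^{−xφ^{−1}(u)}, so that as measures ∫_0^u G_s(·) ds = u F_u(·). -/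

import Mathlib

open MeasureTheory ProbabilityTheory Real Set Filter Topology
open scoped ENNReal NNReal BigOperators

/-- The Laplace transform `φ(y) = ∫ e^{-yx} F(dx)` of a distribution `F`. -/
noncomputable def lapl (F : Measure ℝ) (y : ℝ) : ℝ := ∫ x, Real.exp (-(y * x)) ∂F

/-- The distribution `G_u(dx) = x e^{-xφ⁻¹(u)} F(dx) / (-φ'(φ⁻¹(u)))`, where `ψ = φ⁻¹` and
`-φ'(y) = ∫ t e^{-yt} F(dt)`. -/
noncomputable def Gmeas (F : Measure ℝ) (ψ : ℝ → ℝ) (u : ℝ) : Measure ℝ :=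
  F.withDensity fun x =>
    ENNReal.ofReal (x * Real.exp (-(ψ u * x)) / ∫ t, t * Real.exp (-(ψ u * t)) ∂F)

/-- The distribution `F_u(dx) = u⁻¹ e^{-xφ⁻¹(u)} F(dx)`, where `ψ = φ⁻¹`. -/
noncomputable def Fumeas (F : Measure ℝ) (ψ : ℝ → ℝ) (u : ℝ) : Measure ℝ :=
  F.withDensity fun x => ENNReal.ofReal (u⁻¹ * Real.exp (-(ψ u * x)))

/-- An integrable function that is positive almost everywhere has a positive integral. -/
theorem integral_pos_of_ae_pos_of_integrable {α : Type*} [MeasurableSpace α] {μ : Measure α}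
    [NeZero μ] {f : α → ℝ} (hf : Integrable f μ) (hpos : ∀ᵐ x ∂μ, 0 < f x) :
    0 < ∫ x, f x ∂μ := by
  rw [integral_pos_iff_support_of_nonneg_ae (hpos.mono fun _ hx => hx.le) hf]
  refine pos_iff_ne_zero.mpr fun h0 => NeZero.ne μ ?_
  have hzero : ∀ᵐ x ∂μ, f x = 0 := by
    simpa [Function.mem_support, ae_iff, Function.support] using h0
  rw [← ae_eq_bot, ← eventually_false_iff_eq_bot]
  filter_upwards [hpos, hzero] with x hx hx0
  exact hx.ne' hx0

section LaplaceTransform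

variable {F : Measure ℝ}

theorem ae_pos_of_measure_Iic_eq_zero (hsupp : F (Iic 0) = 0) : ∀ᵐ x ∂F, 0 < x := by
  rw [ae_iff]
  convert hsupp using 2
  ext x
  simp

theorem integrable_exp_neg_mul [IsFiniteMeasure F] (hpos : ∀ᵐ x ∂F, 0 < x) {y : ℝ}
    (hy : 0 ≤ y) : Integrable (fun x => Real.exp (-(y * x))) F := by
  refine Integrable.mono' (integrable_const (1 : ℝ)) (by fun_prop) ?_
  filter_upwards [hpos] with x hx
  rw [Real.norm_of_nonneg (Real.exp_pos _).le, Real.exp_le_one_iff]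
  have := mul_nonneg hy hx.le
  linarith

theorem norm_mul_exp_neg_mul_le {x y : ℝ} (hx : 0 < x) (hy : 0 ≤ y) :
    ‖x * Real.exp (-(y * x))‖ ≤ x := by
  rw [Real.norm_of_nonneg (by positivity)]
  have h : Real.exp (-(y * x)) ≤ 1 := by
    rw [Real.exp_le_one_iff]
    have := mul_nonneg hy hx.le
    linarith
  exact mul_le_of_le_one_right hx.le h

theorem integrable_mul_exp_neg_mul (hpos : ∀ᵐ x ∂F, 0 < x)
    (hmean : Integrable (fun x => x) F) {y : ℝ} (hy : 0 ≤ y) :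
    Integrable (fun x => x * Real.exp (-(y * x))) F :=
  hmean.mono' (by fun_prop) (hpos.mono fun _ hx => norm_mul_exp_neg_mul_le hx hy)

theorem integral_mul_exp_neg_mul_pos [NeZero F] (hpos : ∀ᵐ x ∂F, 0 < x)
    (hmean : Integrable (fun x => x) F) {y : ℝ} (hy : 0 ≤ y) :
    0 < ∫ x, x * Real.exp (-(y * x)) ∂F :=
  integral_pos_of_ae_pos_of_integrable (integrable_mul_exp_neg_mul hpos hmean hy)
    (hpos.mono fun _ hx => mul_pos hx (Real.exp_pos _))

theorem strictAntiOn_lapl [IsProbabilityMeasure F] (hpos : ∀ᵐ x ∂F, 0 < x) :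
    StrictAntiOn (lapl F) (Ici 0) := by
  intro y hy z hz hyz
  have hsub := integral_pos_of_ae_pos_of_integrable (μ := F)
    ((integrable_exp_neg_mul hpos hy).sub (integrable_exp_neg_mul hpos hz)) (by
      filter_upwards [hpos] with x hx
      have h := mul_lt_mul_of_pos_right hyz hx
      simpa using h)
  rw [integral_sub' (integrable_exp_neg_mul hpos hy) (integrable_exp_neg_mul hpos hz)] at hsub
  exact sub_pos.mp hsub

theorem lapl_mem_Ioo [IsProbabilityMeasure F] (hpos : ∀ᵐ x ∂F, 0 < x) {y : ℝ} (hy : 0 < y) :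
    lapl F y ∈ Ioo (0 : ℝ) 1 := by
  constructor
  · exact integral_pos_of_ae_pos_of_integrable (integrable_exp_neg_mul hpos hy.le)
      (ae_of_all _ fun _ => Real.exp_pos _)
  · have h0 : lapl F 0 = 1 := by simp [lapl]
    rw [← h0]
    exact strictAntiOn_lapl hpos self_mem_Ici hy.le hy

theorem hasDerivAt_lapl [IsFiniteMeasure F] (hpos : ∀ᵐ x ∂F, 0 < x)
    (hmean : Integrable (fun x => x) F) {y : ℝ} (hy : 0 < y) :
    HasDerivAt (lapl F) (-∫ x, x * Real.exp (-(y * x)) ∂F) y := by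
  rw [← integral_neg]
  refine (hasDerivAt_integral_of_dominated_loc_of_deriv_le (s := Ioi 0) (bound := fun x => x)
    (F' := fun z x => -(x * Real.exp (-(z * x)))) (Ioi_mem_nhds hy)
    (Eventually.of_forall fun z => by fun_prop) (integrable_exp_neg_mul hpos hy.le)
    (by fun_prop) ?_ hmean ?_).2
  · filter_upwards [hpos] with x hx z hz
    rw [norm_neg]
    exact norm_mul_exp_neg_mul_le hx (le_of_lt hz)
  · refine ae_of_all _ fun x z _ => ?_
    have h := ((hasDerivAt_mul_const (x := z) x).neg).exp
    refine h.congr_deriv ?_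
    simp only [Pi.neg_apply]
    ring

theorem measurable_integral_mul_exp_neg_mul [SFinite F] :
    Measurable fun y : ℝ => ∫ t, t * Real.exp (-(y * t)) ∂F := by
  refine StronglyMeasurable.measurable ?_
  refine StronglyMeasurable.integral_prod_right'
    (f := fun p : ℝ × ℝ => p.2 * Real.exp (-(p.1 * p.2))) ?_
  exact Measurable.stronglyMeasurable (by fun_prop)

section Inverse

variable [IsProbabilityMeasure F] {ψ : ℝ → ℝ}

theorem inverse_lapl_apply (hpos : ∀ᵐ x ∂F, 0 < x)
    (hψ : ∀ u ∈ Ioo (0 : ℝ) 1, 0 < ψ u ∧ lapl F (ψ u) = u) {y : ℝ} (hy : 0 < y) :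
    ψ (lapl F y) = y := by
  obtain ⟨h1, h2⟩ := hψ _ (lapl_mem_Ioo hpos hy)
  exact (strictAntiOn_lapl hpos).injOn h1.le hy.le h2

theorem strictAntiOn_inverse_lapl (hpos : ∀ᵐ x ∂F, 0 < x)
    (hψ : ∀ u ∈ Ioo (0 : ℝ) 1, 0 < ψ u ∧ lapl F (ψ u) = u) :
    StrictAntiOn ψ (Ioo 0 1) := by
  intro s hs t ht hst
  rw [← (hψ s hs).2, ← (hψ t ht).2] at hst
  exact ((strictAntiOn_lapl hpos).lt_iff_gt (hψ s hs).1.le (hψ t ht).1.le).mp hst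

theorem continuousAt_inverse_lapl (hpos : ∀ᵐ x ∂F, 0 < x)
    (hψ : ∀ u ∈ Ioo (0 : ℝ) 1, 0 < ψ u ∧ lapl F (ψ u) = u) {s : ℝ} (hs : s ∈ Ioo (0 : ℝ) 1) :
    ContinuousAt ψ s := by
  have hmono : MonotoneOn (fun t => -ψ t) (Ioo 0 1) :=
    (strictAntiOn_inverse_lapl hpos hψ).antitoneOn.neg
  have himage : (fun t => -ψ t) '' Ioo 0 1 ∈ 𝓝 (-ψ s) := by
    filter_upwards [Iio_mem_nhds (neg_lt_zero.mpr (hψ s hs).1)] with y hy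
    have hy' : 0 < -y := neg_pos.mpr hy
    exact ⟨lapl F (-y), lapl_mem_Ioo hpos hy', by simp [inverse_lapl_apply hpos hψ hy']⟩
  exact continuousAt_neg_iff.mp
    (continuousAt_of_monotoneOn_of_image_mem_nhds hmono (isOpen_Ioo.mem_nhds hs) himage)

theorem tendsto_inverse_lapl_atTop (hpos : ∀ᵐ x ∂F, 0 < x)
    (hψ : ∀ u ∈ Ioo (0 : ℝ) 1, 0 < ψ u ∧ lapl F (ψ u) = u) :
    Tendsto ψ (𝓝[>] 0) atTop := by
  refine tendsto_atTop.mpr fun M => ?_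
  have hM : 0 < max M 1 := lt_max_of_lt_right one_pos
  obtain ⟨h0, h1⟩ := lapl_mem_Ioo hpos hM
  filter_upwards [Ioo_mem_nhdsGT h0] with s hs
  have h := strictAntiOn_inverse_lapl hpos hψ ⟨hs.1, hs.2.trans h1⟩ ⟨h0, h1⟩ hs.2
  rw [inverse_lapl_apply hpos hψ hM] at h
  exact (le_max_left _ _).trans h.le

theorem hasDerivAt_inverse_lapl (hpos : ∀ᵐ x ∂F, 0 < x) (hmean : Integrable (fun x => x) F)
    (hψ : ∀ u ∈ Ioo (0 : ℝ) 1, 0 < ψ u ∧ lapl F (ψ u) = u) {s : ℝ} (hs : s ∈ Ioo (0 : ℝ) 1) :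
    HasDerivAt ψ (-∫ t, t * Real.exp (-(ψ s * t)) ∂F)⁻¹ s := by
  refine (hasDerivAt_lapl hpos hmean (hψ s hs).1).of_local_left_inverse
    (continuousAt_inverse_lapl hpos hψ hs)
    (neg_ne_zero.mpr (integral_mul_exp_neg_mul_pos hpos hmean (hψ s hs).1.le).ne') ?_
  filter_upwards [isOpen_Ioo.mem_nhds hs] with t ht using (hψ t ht).2

theorem hasDerivAt_exp_neg_inverse_lapl_mul (hpos : ∀ᵐ x ∂F, 0 < x)
    (hmean : Integrable (fun x => x) F)
    (hψ : ∀ u ∈ Ioo (0 : ℝ) 1, 0 < ψ u ∧ lapl F (ψ u) = u) (x : ℝ) {s : ℝ}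
    (hs : s ∈ Ioo (0 : ℝ) 1) :
    HasDerivAt (fun s => Real.exp (-(ψ s * x)))
      (x * Real.exp (-(ψ s * x)) / ∫ t, t * Real.exp (-(ψ s * t)) ∂F) s := by
  have h := (((hasDerivAt_inverse_lapl hpos hmean hψ hs).mul_const x).neg).exp
  refine h.congr_deriv ?_
  simp only [Pi.neg_apply, inv_neg]
  ring

/-- The density of `G_s` is integrable in `s` over `(0,u)`, with integral `e^{-xψ(u)}`. -/
theorem integrableOn_and_integral_density (hpos : ∀ᵐ x ∂F, 0 < x)
    (hmean : Integrable (fun x => x) F)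
    (hψ : ∀ u ∈ Ioo (0 : ℝ) 1, 0 < ψ u ∧ lapl F (ψ u) = u) {u : ℝ}
    (hu : u ∈ Ioo (0 : ℝ) 1) {x : ℝ} (hx : 0 < x) :
    IntegrableOn (fun s => x * Real.exp (-(ψ s * x)) / ∫ t, t * Real.exp (-(ψ s * t)) ∂F)
      (Ioo 0 u) ∧
    (∫ s in Ioo (0 : ℝ) u,
      x * Real.exp (-(ψ s * x)) / ∫ t, t * Real.exp (-(ψ s * t)) ∂F)
        = Real.exp (-(ψ u * x)) := by
  set g : ℝ → ℝ := Function.update (fun s => Real.exp (-(ψ s * x))) 0 0 with hg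
  have hgne : ∀ s, 0 < s → g s = Real.exp (-(ψ s * x)) := fun s hs => by
    simp [hg, Function.update_of_ne hs.ne']
  have hmem : ∀ s ∈ Ioo 0 u, s ∈ Ioo (0 : ℝ) 1 := fun s hs => ⟨hs.1, hs.2.trans hu.2⟩
  have hcont : ContinuousOn g (Icc 0 u) := by
    rw [hg, continuousOn_update_iff]
    constructor
    · rintro s ⟨⟨hs0, hsu⟩, hs⟩
      have hs' : s ∈ Ioo (0 : ℝ) 1 := ⟨lt_of_le_of_ne hs0 (Ne.symm hs), hsu.trans_lt hu.2⟩
      exact (hasDerivAt_exp_neg_inverse_lapl_mul hpos hmean hψ x hs').continuousAt.continuousWithinAt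
    · intro _
      have hlim : Tendsto (fun s => Real.exp (-(ψ s * x))) (𝓝[>] 0) (𝓝 0) :=
        Real.tendsto_exp_neg_atTop_nhds_zero.comp
          ((tendsto_inverse_lapl_atTop hpos hψ).atTop_mul_const hx)
      exact hlim.mono_left
        (nhdsWithin_mono _ fun s hs => lt_of_le_of_ne hs.1.1 (Ne.symm hs.2))
  have hderiv : ∀ s ∈ Ioo 0 u, HasDerivAt g
      (x * Real.exp (-(ψ s * x)) / ∫ t, t * Real.exp (-(ψ s * t)) ∂F) s := fun s hs =>
    (hasDerivAt_exp_neg_inverse_lapl_mul hpos hmean hψ x (hmem s hs)).congr_of_eventuallyEq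
      (by filter_upwards [Ioi_mem_nhds hs.1] with t ht using hgne t ht)
  have hdens : IntegrableOn
      (fun s => x * Real.exp (-(ψ s * x)) / ∫ t, t * Real.exp (-(ψ s * t)) ∂F) (Ioc 0 u) :=
    intervalIntegral.integrableOn_deriv_of_nonneg hcont hderiv fun s hs =>
      div_nonneg (mul_pos hx (Real.exp_pos _)).le
        (integral_mul_exp_neg_mul_pos hpos hmean (hψ s (hmem s hs)).1.le).le
  refine ⟨hdens.mono_set Ioo_subset_Ioc_self, ?_⟩
  rw [← integral_Ioc_eq_integral_Ioo, ← intervalIntegral.integral_of_le hu.1.le,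
    intervalIntegral.integral_eq_sub_of_hasDerivAt_of_le hu.1.le hcont hderiv
      ((intervalIntegrable_iff_integrableOn_Ioc_of_le hu.1.le).mpr hdens), hgne u hu.1]
  simp [hg]

theorem lintegral_Gmeas (hpos : ∀ᵐ x ∂F, 0 < x) (hmean : Integrable (fun x => x) F)
    (hψ : ∀ u ∈ Ioo (0 : ℝ) 1, 0 < ψ u ∧ lapl F (ψ u) = u) {u : ℝ}
    (hu : u ∈ Ioo (0 : ℝ) 1) {A : Set ℝ} (hA : MeasurableSet A) :
    (∫⁻ s in Ioo (0 : ℝ) u, Gmeas F ψ s A) = ENNReal.ofReal u * Fumeas F ψ u A := by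
  have hψm : AEMeasurable ψ (volume.restrict (Ioo 0 u)) :=
    ContinuousOn.aemeasurable (fun s hs => (continuousAt_inverse_lapl hpos hψ
      ⟨hs.1, hs.2.trans hu.2⟩).continuousWithinAt) measurableSet_Ioo
  have hjoint : AEMeasurable (Function.uncurry fun s x => ENNReal.ofReal
      (x * Real.exp (-(ψ s * x)) / ∫ t, t * Real.exp (-(ψ s * t)) ∂F))
      ((volume.restrict (Ioo 0 u)).prod (F.restrict A)) := by
    have hfst : AEMeasurable (fun p : ℝ × ℝ => ψ p.1)
        ((volume.restrict (Ioo 0 u)).prod (F.restrict A)) := hψm.comp_fst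
    exact ((measurable_snd.aemeasurable.mul (hfst.mul measurable_snd.aemeasurable).neg.exp).div
      (measurable_integral_mul_exp_neg_mul.comp_aemeasurable hfst)).ennreal_ofReal
  have hinner : ∀ᵐ x ∂(F.restrict A),
      (∫⁻ s in Ioo (0 : ℝ) u, ENNReal.ofReal
        (x * Real.exp (-(ψ s * x)) / ∫ t, t * Real.exp (-(ψ s * t)) ∂F))
        = ENNReal.ofReal u * ENNReal.ofReal (u⁻¹ * Real.exp (-(ψ u * x))) := by
    filter_upwards [ae_restrict_of_ae hpos] with x hx
    obtain ⟨hdens, hval⟩ := integrableOn_and_integral_density hpos hmean hψ hu hx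
    rw [← ofReal_integral_eq_lintegral_ofReal hdens, hval, ← ENNReal.ofReal_mul hu.1.le,
      mul_inv_cancel_left₀ hu.1.ne']
    filter_upwards [ae_restrict_mem measurableSet_Ioo] with s hs
    exact div_nonneg (mul_pos hx (Real.exp_pos _)).le
      (integral_mul_exp_neg_mul_pos hpos hmean (hψ s ⟨hs.1, hs.2.trans hu.2⟩).1.le).le
  simp only [Gmeas, Fumeas, withDensity_apply _ hA]
  rw [lintegral_lintegral_swap hjoint, lintegral_congr_ae hinner,
    lintegral_const_mul _ (by fun_prop)]

end Inverse

end LaplaceTransform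

/-- For `F` supported on `(0,∞)` with finite mean and `u ∈ (0,1)`:
(i) `F_u` is a probability measure with mean `μ_u = -φ'(φ⁻¹(u))/u`;
(ii) `G_u(dx) = x F_u(dx)/μ_u`;
(iii) `∫₀ᵘ x e^{-xφ⁻¹(s)}/(-φ'(φ⁻¹(s))) ds = e^{-xφ⁻¹(u)}` for every `x > 0`, so that as
measures `∫₀ᵘ G_s(·) ds = u F_u(·)`. -/
theorem Fu_Gu_evolution
    (F : Measure ℝ) [IsProbabilityMeasure F] (hsupp : F (Iic 0) = 0)
    (hmean : Integrable (fun x => x) F)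
    (ψ : ℝ → ℝ) (hψ : ∀ u ∈ Ioo (0:ℝ) 1, 0 < ψ u ∧ lapl F (ψ u) = u)
    (u : ℝ) (hu : u ∈ Ioo (0:ℝ) 1) :
    IsProbabilityMeasure (Fumeas F ψ u) ∧
    (∫ x, x ∂(Fumeas F ψ u)) = (∫ x, x * Real.exp (-(ψ u * x)) ∂F) / u ∧
    Gmeas F ψ u
      = (Fumeas F ψ u).withDensity
          (fun x => ENNReal.ofReal (x / ((∫ t, t * Real.exp (-(ψ u * t)) ∂F) / u))) ∧
    (∀ x : ℝ, 0 < x →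
      (∫ s in Ioo (0:ℝ) u,
          x * Real.exp (-(ψ s * x)) / ∫ t, t * Real.exp (-(ψ s * t)) ∂F)
        = Real.exp (-(ψ u * x))) ∧
    (∀ A : Set ℝ, MeasurableSet A →
      (∫⁻ s in Ioo (0:ℝ) u, Gmeas F ψ s A) = ENNReal.ofReal u * Fumeas F ψ u A) := by
  have hpos := ae_pos_of_measure_Iic_eq_zero hsupp
  obtain ⟨hψu, hlu⟩ := hψ u hu
  have hu0 : 0 < u := hu.1
  refine ⟨⟨?_⟩, ?_, ?_, fun x hx => (integrableOn_and_integral_density hpos hmean hψ hu hx).2,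
    fun A hA => lintegral_Gmeas hpos hmean hψ hu hA⟩
  · rw [Fumeas, withDensity_apply _ MeasurableSet.univ, Measure.restrict_univ,
      ← ofReal_integral_eq_lintegral_ofReal ((integrable_exp_neg_mul hpos hψu.le).const_mul _)
        (ae_of_all _ fun _ => by positivity), integral_const_mul]
    rw [lapl] at hlu
    rw [hlu, inv_mul_cancel₀ hu0.ne', ENNReal.ofReal_one]
  · rw [Fumeas, integral_withDensity_eq_integral_toReal_smul (by fun_prop)
      (ae_of_all _ fun _ => ENNReal.ofReal_lt_top), div_eq_inv_mul, ← integral_const_mul]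
    refine integral_congr_ae (ae_of_all _ fun x => ?_)
    simp only [smul_eq_mul]
    rw [ENNReal.toReal_ofReal (by positivity)]
    ring
  · rw [Fumeas, ← withDensity_mul _ (by fun_prop) (by fun_prop), Gmeas]
    congr 1
    ext x
    rw [Pi.mul_apply, ← ENNReal.ofReal_mul (by positivity)]
    congr 1
    field_simp
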